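/- Let L > 0, let x₀ ∈ ℝ², let D_L(x₀) = {x ∈ ℝ² : |x − x₀| < L} and let H ⊂ ℝ² be a (closed) half-plane such that x₀ ∈ H and dist(x₀, ∂H) = L. Then ∫_{H \ D_L(x₀)} |x − x₀|^{-3} dx = 2(π − 1)/L. -/

import Mathlib

open MeasureTheory Metric

lemma hp_inner (L : ℝ) (hL : 0 < L) (c : ℝ) (hc : c ≤ 1) :
    ∫ r in Set.Ioi (0:ℝ), (if L ≤ r ∧ r * c ≤ L then (r ^ 2)⁻¹ else 0) = (1 - max c 0) / L := by
  have h1 : ∀ r : ℝ, (if L ≤ r ∧ r * c ≤ L then (r ^ 2)⁻¹ else 0)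
      = Set.indicator {r : ℝ | L ≤ r ∧ r * c ≤ L} (fun r => (r ^ 2)⁻¹) r := by
    intro r; simp [Set.indicator]
  have hm : MeasurableSet {r : ℝ | L ≤ r ∧ r * c ≤ L} := by
    have a1 : MeasurableSet {r : ℝ | L ≤ r} := measurableSet_Ici
    have a2 : MeasurableSet {r : ℝ | r * c ≤ L} := measurableSet_le (by fun_prop) (by fun_prop)
    exact a1.inter a2
  simp_rw [h1]
  rw [setIntegral_indicator hm]
  rcases le_or_gt c 0 with h | h
  · have : Set.Ioi 0 ∩ {r : ℝ | L ≤ r ∧ r * c ≤ L} = Set.Ici L := by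
      ext r
      simp only [Set.mem_inter_iff, Set.mem_Ioi, Set.mem_ofPred_eq, Set.mem_Ici]
      constructor
      · tauto
      · intro hr
        refine ⟨by linarith, hr, ?_⟩
        have : r * c ≤ 0 := mul_nonpos_of_nonneg_of_nonpos (by linarith) h
        linarith
    rw [this, integral_Ici_eq_integral_Ioi, max_eq_right h]
    have := integral_Ioi_rpow_of_lt (a := -2) (by norm_num) hL
    rw [show (1 - 0) / L = -L ^ ((-2:ℝ) + 1) / (-2 + 1) by
      norm_num [Real.rpow_neg_one], ← this]
    refine setIntegral_congr_fun measurableSet_Ioi fun x hx => ?_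
    have hx0 : (0:ℝ) ≤ x := by simp at hx; linarith
    show (x^2)⁻¹ = x ^ (-2:ℝ)
    rw [Real.rpow_neg hx0]; norm_num
  · have hLc : L ≤ L / c := by rw [le_div_iff₀ h]; nlinarith
    have : Set.Ioi 0 ∩ {r : ℝ | L ≤ r ∧ r * c ≤ L} = Set.Icc L (L / c) := by
      ext r
      simp only [Set.mem_inter_iff, Set.mem_Ioi, Set.mem_ofPred_eq, Set.mem_Icc, le_div_iff₀ h]
      constructor
      · tauto
      · intro hr
        exact ⟨by linarith, hr⟩
    rw [this, integral_Icc_eq_integral_Ioc, max_eq_left h.le,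
      ← intervalIntegral.integral_of_le hLc]
    rw [intervalIntegral.integral_eq_sub_of_hasDerivAt (f := fun r => - r⁻¹)]
    · field_simp; ring
    · intro x hx
      rw [Set.uIcc_of_le hLc] at hx
      have : x ≠ 0 := by have := hx.1; linarith
      have h := (hasDerivAt_inv this).neg
      rw [neg_neg] at h
      exact h
    · apply ContinuousOn.intervalIntegrable
      intro x hx
      rw [Set.uIcc_of_le hLc] at hx
      have : x ≠ 0 := by have := hx.1; linarith
      have : x ^ 2 ≠ 0 := by positivity
      exact ContinuousAt.continuousWithinAt (by fun_prop (disch := assumption))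

lemma hp_outer : ∫ t in Set.Ioo (-Real.pi) Real.pi, max (Real.cos t) 0 = 2 := by
  have hpi := Real.pi_pos
  rw [← integral_Ioc_eq_integral_Ioo, ← intervalIntegral.integral_of_le (by linarith)]
  have hi : ∀ a b, IntervalIntegrable (fun t => max (Real.cos t) 0) volume a b := fun a b =>
    Continuous.intervalIntegrable (by fun_prop) _ _
  rw [← intervalIntegral.integral_add_adjacent_intervals (hi _ (-(Real.pi/2))) (hi _ _),
    ← intervalIntegral.integral_add_adjacent_intervals (hi _ (Real.pi/2)) (hi _ Real.pi)]
  have e1 : ∫ t in (-Real.pi)..(-(Real.pi/2)), max (Real.cos t) 0 = ∫ t in (-Real.pi)..(-(Real.pi/2)), 0 := by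
    refine intervalIntegral.integral_congr fun t ht => ?_
    rw [Set.uIcc_of_le (by linarith)] at ht
    apply max_eq_right
    rw [← Real.cos_neg]
    exact Real.cos_nonpos_of_pi_div_two_le_of_le (by linarith [ht.2]) (by linarith [ht.1])
  have e2 : ∫ t in (Real.pi/2)..Real.pi, max (Real.cos t) 0 = ∫ t in (Real.pi/2)..Real.pi, 0 := by
    refine intervalIntegral.integral_congr fun t ht => ?_
    rw [Set.uIcc_of_le (by linarith)] at ht
    apply max_eq_right
    exact Real.cos_nonpos_of_pi_div_two_le_of_le (by linarith [ht.1]) (by linarith [ht.2])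
  have e3 : ∫ t in (-(Real.pi/2))..(Real.pi/2), max (Real.cos t) 0
      = ∫ t in (-(Real.pi/2))..(Real.pi/2), Real.cos t := by
    refine intervalIntegral.integral_congr fun t ht => ?_
    rw [Set.uIcc_of_le (by linarith)] at ht
    apply max_eq_left
    exact Real.cos_nonneg_of_mem_Icc ht
  rw [e1, e2, e3, integral_cos]
  simp; norm_num

lemma hp_complex (L : ℝ) (hL : 0 < L) :
    ∫ z in {z : ℂ | z.re ≤ L ∧ L ≤ ‖z‖}, (‖z‖ ^ 3)⁻¹ = 2 * (Real.pi - 1) / L := by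
  have hm : MeasurableSet {z : ℂ | z.re ≤ L ∧ L ≤ ‖z‖} := by
    have a1 : MeasurableSet {z : ℂ | z.re ≤ L} := measurableSet_le (by fun_prop) (by fun_prop)
    have a2 : MeasurableSet {z : ℂ | L ≤ ‖z‖} := measurableSet_le (by fun_prop) (by fun_prop)
    exact a1.inter a2
  rw [← integral_indicator hm, ← Complex.integral_comp_polarCoord_symm]
  set F : ℝ × ℝ → ℝ := fun p =>
    if L ≤ p.1 ∧ p.1 * Real.cos p.2 ≤ L then (p.1 ^ 2)⁻¹ else 0 with hF
  have hFm : Measurable F := by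
    apply Measurable.ite
    · have a1 : MeasurableSet {p : ℝ × ℝ | L ≤ p.1} :=
        measurableSet_le (by fun_prop) (by fun_prop)
      have a2 : MeasurableSet {p : ℝ × ℝ | p.1 * Real.cos p.2 ≤ L} :=
        measurableSet_le (by fun_prop) (by fun_prop)
      exact a1.inter a2
    · fun_prop
    · fun_prop
  have hcongr : ∫ p in polarCoord.target, p.1 •
      Set.indicator {z : ℂ | z.re ≤ L ∧ L ≤ ‖z‖} (fun z => (‖z‖ ^ 3)⁻¹) (Complex.polarCoord.symm p)
      = ∫ p in Set.Ioi (0:ℝ) ×ˢ Set.Ioo (-Real.pi) Real.pi, F p := by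
    refine setIntegral_congr_fun (measurableSet_Ioi.prod measurableSet_Ioo) fun p hp => ?_
    have hp0 : 0 < p.1 := hp.1
    have hn : ‖Complex.polarCoord.symm p‖ = p.1 := by
      rw [Complex.norm_polarCoord_symm, abs_of_pos hp0]
    have hr : (Complex.polarCoord.symm p).re = p.1 * Real.cos p.2 := by
      rw [Complex.polarCoord_symm_apply]; simp [← Complex.ofReal_cos, ← Complex.ofReal_sin]
    simp only [Set.indicator, Set.mem_ofPred_eq, hn, hr, hF, and_comm, smul_eq_mul]
    split_ifs
    · field_simp
    · simp
  rw [hcongr, Measure.volume_eq_prod, ← Measure.prod_restrict]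
  have hint : Integrable F ((volume.restrict (Set.Ioi (0:ℝ))).prod
      (volume.restrict (Set.Ioo (-Real.pi) Real.pi))) := by
    have h1 : Integrable (Set.indicator (Set.Ici L) fun r : ℝ => r ^ (-2:ℝ))
        (volume.restrict (Set.Ioi (0:ℝ))) := by
      apply Integrable.restrict
      rw [integrable_indicator_iff measurableSet_Ici, integrableOn_Ici_iff_integrableOn_Ioi]
      exact integrableOn_Ioi_rpow_of_lt (by norm_num) hL
    have h2 : Integrable (fun _ : ℝ => (1:ℝ)) (volume.restrict (Set.Ioo (-Real.pi) Real.pi)) := by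
      simp
    refine (h1.mul_prod h2).mono hFm.aestronglyMeasurable (Filter.Eventually.of_forall fun p => ?_)
    simp only [hF, Set.indicator, Set.mem_Ici, mul_one]
    by_cases h : L ≤ p.1
    · have hx0 : (0:ℝ) ≤ p.1 := by linarith
      have : p.1 ^ (-2:ℝ) = (p.1 ^ 2)⁻¹ := by rw [Real.rpow_neg hx0]; norm_num
      simp only [h, true_and, if_true, this]
      split_ifs
      · rfl
      · simp; positivity
    · simp [h]
  rw [integral_prod_symm F hint]
  simp_rw [hF, hp_inner L hL _ (Real.cos_le_one _)]
  rw [integral_div, integral_sub, hp_outer]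
  · simp [Real.pi_pos.le]; ring
  · simp
  · exact (Continuous.integrableOn_Icc (by fun_prop)).mono_set Set.Ioo_subset_Icc_self

/-- **Half-plane integral.** Let `H = {x : ⟪x, ν⟫ ≤ c}` be a closed half-plane in `ℝ²`
(`ν` a unit normal), and let `x₀ ∈ H` be at distance `L > 0` from the boundary line
`∂H` (equivalently `⟪x₀, ν⟫ = c - L`). Then
`∫_{H \ D_L(x₀)} |x - x₀|⁻³ dx = 2(π - 1)/L`. -/
theorem halfplane_integral_two_dim
    (L : ℝ) (hL : 0 < L)
    (x₀ ν : EuclideanSpace ℝ (Fin 2)) (c : ℝ) (hν : ‖ν‖ = 1)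
    (H : Set (EuclideanSpace ℝ (Fin 2)))
    (hH : H = {x : EuclideanSpace ℝ (Fin 2) | (inner ℝ x ν : ℝ) ≤ c})
    (hx₀ : (inner ℝ x₀ ν : ℝ) = c - L) :
    ∫ x in H \ ball x₀ L, (‖x - x₀‖ ^ 3)⁻¹ = 2 * (Real.pi - 1) / L := by
  have hon : Orthonormal ℝ (Set.domRestrict ({0} : Set (Fin 2)) (fun _ => ν)) := by
    constructor
    · intro i; exact hν
    · intro i j hij
      exact absurd (Subsingleton.elim i j) hij
  obtain ⟨b, hb⟩ := hon.exists_orthonormalBasis_extension_of_card_eq (by simp)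
  have hb0 : b 0 = ν := hb 0 rfl
  let e : ℂ ≃ₗᵢ[ℝ] EuclideanSpace ℝ (Fin 2) :=
    Complex.orthonormalBasisOneI.equiv b (Equiv.refl _)
  have he1 : e 1 = ν := by
    have := Complex.orthonormalBasisOneI.equiv_apply_basis b (Equiv.refl _) 0
    simpa [hb0] using this
  have hmp : MeasurePreserving (fun z => e z + x₀) volume volume :=
    (measurePreserving_add_right volume x₀).comp e.measurePreserving
  have hemb : MeasurableEmbedding (fun z => e z + x₀) :=
    (measurableEmbedding_addRight x₀).comp e.toHomeomorph.measurableEmbedding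
  rw [← hmp.setIntegral_preimage_emb hemb, ← hp_complex L hL]
  have hset : (fun z => e z + x₀) ⁻¹' (H \ ball x₀ L) = {z : ℂ | z.re ≤ L ∧ L ≤ ‖z‖} := by
    ext z
    have h1 : inner ℝ (e z) ν = z.re := by
      rw [← he1, e.inner_map_map, Complex.inner]; simp
    simp only [hH, Set.mem_preimage, Set.mem_sdiff, Set.mem_ofPred_eq, mem_ball, dist_eq_norm,
      add_sub_cancel_right, e.norm_map, inner_add_left, h1, hx₀, not_lt]
    constructor <;> rintro ⟨h, h'⟩ <;> exact ⟨by linarith, h'⟩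
  rw [hset]
  simp
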